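/- arXiv:1706.07022 — 5 statements merged into one kernel-verified Lean document; each statement's English description precedes it below -/
import Mathlib

section
/- For any rank sequence r for n, the variety Comp(n,r) equals the Zariski closure of Comp^0(n,r); in particular, Comp(n,r) is an irreducible closed subvariety of Comp(n). -/
/-!  Circular complexes framework: `K` algebraically closed, char 0;
`n : ZMod l → ℕ` a tuple of positive integers. -/

open MvPolynomial in
/-- The Zariski topology on the affine space `ι → K`: the topology generated by the
basic open sets `{x | p(x) ≠ 0}` for polynomials `p`. -/
def zariskiTopology (ι K : Type) [CommSemiring K] : TopologicalSpace (ι → K) :=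
  .generateFrom { U | ∃ p : MvPolynomial ι K, U = { x | eval x p ≠ 0 } }

/-- The ambient affine space `∏_{i ∈ ℤ/lℤ} Mat_{n_{i+1} × n_i}(K)` in which the
variety of circular complexes lives. -/
abbrev CompSpace (K : Type) [Field K] {l : ℕ} (n : ZMod l → ℕ) : Type :=
  ∀ i : ZMod l, Matrix (Fin (n (i + 1))) (Fin (n i)) K

/-- Coordinates on `CompSpace K n`. -/
def compCoord {K : Type} [Field K] {l : ℕ} (n : ZMod l → ℕ) :
    CompSpace K n → ((Σ i : ZMod l, Fin (n (i + 1)) × Fin (n i)) → K) :=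
  fun A q => A q.1 q.2.1 q.2.2

/-- The Zariski topology on `CompSpace K n`, induced from the Zariski topology on
coordinates. -/
def compTopology (K : Type) [Field K] {l : ℕ} (n : ZMod l → ℕ) :
    TopologicalSpace (CompSpace K n) :=
  (zariskiTopology _ K).induced (compCoord n)

/-- `Comp(𝐧)`, the variety of circular complexes: tuples `(A_i)` with
`A_{i+1} A_i = 0` for all `i ∈ ℤ/lℤ`. -/
def Comp (K : Type) [Field K] {l : ℕ} (n : ZMod l → ℕ) : Set (CompSpace K n) :=
  { A | ∀ i : ZMod l, A (i + 1) * A i = 0 }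

/-- `Comp(𝐧,𝐫)`: circular complexes with `rank A_i ≤ r_i` for all `i`. -/
def CompR (K : Type) [Field K] {l : ℕ} (n r : ZMod l → ℕ) : Set (CompSpace K n) :=
  { A ∈ Comp K n | ∀ i, (A i).rank ≤ r i }

/-- `Comp⁰(𝐧,𝐫)`: circular complexes with `rank A_i = r_i` for all `i`. -/
def Comp0 (K : Type) [Field K] {l : ℕ} (n r : ZMod l → ℕ) : Set (CompSpace K n) :=
  { A ∈ Comp K n | ∀ i, (A i).rank = r i }

/-- `r` is a rank sequence for `n`: it is realized by some circular complex. -/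
def IsRankSeq (K : Type) [Field K] {l : ℕ} (n r : ZMod l → ℕ) : Prop :=
  ∃ A ∈ Comp K n, ∀ i, (A i).rank = r i

open Matrix Module Topology

/-- Between nested subspaces there is a subspace of any prescribed intermediate dimension. -/
theorem Submodule.exists_between_finrank_eq {K V : Type*} [Field K] [AddCommGroup V] [Module K V]
    [FiniteDimensional K V] {W₁ W₂ : Submodule K V} (h : W₁ ≤ W₂) {s : ℕ}
    (h₁ : finrank K W₁ ≤ s) (h₂ : s ≤ finrank K W₂) :
    ∃ U : Submodule K V, W₁ ≤ U ∧ U ≤ W₂ ∧ finrank K U = s := by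
  induction s, h₁ using Nat.le_induction with
  | base => exact ⟨W₁, le_rfl, h, rfl⟩
  | succ s _ ih =>
    obtain ⟨U, hU₁, hU₂, hU⟩ := ih (by omega)
    have hlt : U < W₂ := lt_of_le_of_ne hU₂ (by rintro rfl; omega)
    obtain ⟨v, hv, hvU⟩ := SetLike.exists_of_lt hlt
    refine ⟨U ⊔ Submodule.span K {v}, hU₁.trans le_sup_left, sup_le hU₂ ?_, ?_⟩
    · simpa using hv
    · rw [finrank_sup_span_singleton hvU, hU]

theorem Matrix.exists_idempotent_rank_eq {K : Type*} [Field K] {m s : ℕ} (h : s ≤ m) :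
    ∃ E : Matrix (Fin m) (Fin m) K, E * E = E ∧ E.rank = s := by
  classical
  refine ⟨diagonal fun j => if (j : ℕ) < s then 1 else 0, by simp, ?_⟩
  rw [rank_diagonal]
  simp only [ne_eq, ite_eq_right_iff, one_ne_zero, imp_false, not_not]
  rw [Fintype.card_subtype, Fin.card_filter_val_lt]
  omega

/-- If `X * Y = 0` and `E` is an idempotent whose rank lies between the rank of `Y` and the
nullity of `X`, then after a change of basis the range of `E` lies between the range of `Y` and
the kernel of `X`. -/
theorem Matrix.exists_conj_idempotent {K : Type*} [Field K] {k m q : ℕ}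
    {X : Matrix (Fin k) (Fin m) K} {Y : Matrix (Fin m) (Fin q) K} (hXY : X * Y = 0)
    {E : Matrix (Fin m) (Fin m) K} (hE : E * E = E) (hY : Y.rank ≤ E.rank)
    (hX : X.rank + E.rank ≤ m) :
    ∃ g : Matrix (Fin m) (Fin m) K, g.det ≠ 0 ∧ X * g * E = 0 ∧ E * g⁻¹ * Y = g⁻¹ * Y := by
  have hle : LinearMap.range Y.mulVecLin ≤ LinearMap.ker X.mulVecLin := by
    rw [LinearMap.range_le_ker_iff, ← mulVecLin_mul, hXY, mulVecLin_zero]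
  have hker : X.rank + finrank K (LinearMap.ker X.mulVecLin) = m := by
    simpa [Matrix.rank] using LinearMap.finrank_range_add_finrank_ker X.mulVecLin
  obtain ⟨U, hYU, hUX, hU⟩ := Submodule.exists_between_finrank_eq hle hY (by omega)
  obtain ⟨e, he⟩ := Submodule.exists_linearEquiv_restrict_eq
    (LinearEquiv.ofFinrankEq (LinearMap.range E.mulVecLin) U hU.symm)
  set f := LinearEquiv.ofFinrankEq (LinearMap.range E.mulVecLin) U hU.symm
  have hgdet : IsUnit (LinearMap.toMatrix' (e : (Fin m → K) →ₗ[K] (Fin m → K))).det := by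
    rw [LinearMap.det_toMatrix']
    exact e.isUnit_det'
  set g := LinearMap.toMatrix' (e : (Fin m → K) →ₗ[K] (Fin m → K)) with hg
  have hge : ∀ v, g *ᵥ v = e v := fun v => by
    rw [hg, LinearMap.toMatrix'_mulVec]; rfl
  refine ⟨g, hgdet.ne_zero, ?_, ?_⟩
  · refine Matrix.toLin'.injective (LinearMap.ext fun v => ?_)
    have : e (E *ᵥ v) ∈ U := by
      rw [← he ⟨E *ᵥ v, v, rfl⟩]
      exact Subtype.property _
    simpa [← mulVec_mulVec, hge] using hUX this
  · refine Matrix.toLin'.injective (LinearMap.ext fun v => ?_)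
    obtain ⟨⟨_, w, rfl⟩, hw⟩ := f.surjective ⟨Y *ᵥ v, hYU ⟨v, rfl⟩⟩
    have h₁ : g *ᵥ (E *ᵥ w) = Y *ᵥ v := by
      rw [hge]
      exact (he _).symm.trans (congrArg Subtype.val hw)
    have h₂ : g⁻¹ *ᵥ (Y *ᵥ v) = E *ᵥ w := by
      rw [← h₁, mulVec_mulVec, nonsing_inv_mul _ hgdet, one_mulVec]
    simp only [toLin'_apply, ← mulVec_mulVec, h₂]
    rw [mulVec_mulVec, hE]

/-- A matrix has rank at least `s` if and only if it has an invertible `s × s` compression. -/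
theorem Matrix.le_rank_iff_exists_det_ne_zero {K : Type*} [Field K] {m n s : ℕ}
    (A : Matrix (Fin m) (Fin n) K) :
    s ≤ A.rank ↔ ∃ (P : Matrix (Fin s) (Fin m) K) (Q : Matrix (Fin n) (Fin s) K),
      (P * A * Q).det ≠ 0 := by
  constructor
  · intro h
    obtain ⟨v, hv⟩ := exists_linearIndependent_of_le_finrank (R := K) h
    choose w hw using fun j => (v j).2
    have hv' : LinearIndependent K fun j => (v j : Fin m → K) :=
      hv.map' _ (Submodule.ker_subtype _)
    have hcol : (A * (Matrix.of w)ᵀ).col = fun j => (v j : Fin m → K) := by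
      ext j a
      rw [← hw j]
      simp [Matrix.mul_apply, Matrix.mulVec, dotProduct]
    obtain ⟨f, hf⟩ := (A * (Matrix.of w)ᵀ).mulVecLin.exists_leftInverse_of_injective <|
      LinearMap.ker_eq_bot.2 <| mulVec_injective_iff.2 <| hcol ▸ hv'
    refine ⟨LinearMap.toMatrix' f, (Matrix.of w)ᵀ, ?_⟩
    have hf' := congrArg LinearMap.toMatrix' hf
    rw [LinearMap.toMatrix'_comp, ← Matrix.toLin'_apply', LinearMap.toMatrix'_toLin',
      LinearMap.toMatrix'_id] at hf'
    rw [Matrix.mul_assoc, hf', det_one]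
    exact one_ne_zero
  · rintro ⟨P, Q, h⟩
    have := rank_of_det_ne_zero h
    rw [Fintype.card_fin] at this
    calc s = (P * A * Q).rank := this.symm
      _ ≤ (P * A).rank := rank_mul_le_left _ _
      _ ≤ A.rank := rank_mul_le_right _ _

/-- Choice along the shift `i ↦ i + 1`. -/
theorem exists_forall_add_one {l : ℕ} {α : ZMod l → Type*} {Q : ∀ i, α (i + 1) → Prop}
    (h : ∀ i, ∃ u, Q i u) : ∃ U : ∀ j, α j, ∀ i, Q i (U (i + 1)) := by
  have h' : ∀ j, ∃ u : α j, ∀ i (hi : j = i + 1), Q i (hi ▸ u) := by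
    intro j
    obtain ⟨i, rfl⟩ : ∃ i, j = i + 1 := ⟨j - 1, by ring⟩
    obtain ⟨u, hu⟩ := h i
    refine ⟨u, fun i' hi => ?_⟩
    obtain rfl := add_right_cancel hi
    exact hu
  choose U hU using h'
  exact ⟨U, fun i => hU (i + 1) i rfl⟩

theorem Polynomial.exists_eval_ne_zero {K : Type*} [Field K] [Infinite K] {p : Polynomial K}
    (hp : p ≠ 0) : ∃ t, p.eval t ≠ 0 := by
  contrapose! hp
  exact Polynomial.funext fun t => (hp t).trans Polynomial.eval_zero.symm

section Circular

variable {K : Type} [Field K] {l : ℕ} {n r : ZMod l → ℕ}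

theorem isOpen_eval_compCoord_ne_zero
    (p : MvPolynomial (Σ i : ZMod l, Fin (n (i + 1)) × Fin (n i)) K) :
    IsOpen[compTopology K n] {A | MvPolynomial.eval (compCoord n A) p ≠ 0} :=
  ⟨{x | MvPolynomial.eval x p ≠ 0}, .basic _ ⟨p, rfl⟩, rfl⟩

theorem exists_eval_compCoord_ne_zero {U : Set (CompSpace K n)} (hU : IsOpen[compTopology K n] U)
    {A : CompSpace K n} (hA : A ∈ U) :
    ∃ p, MvPolynomial.eval (compCoord n A) p ≠ 0 ∧
      ∀ B, MvPolynomial.eval (compCoord n B) p ≠ 0 → B ∈ U := by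
  obtain ⟨V, hV, rfl⟩ := hU
  change TopologicalSpace.GenerateOpen _ V at hV
  change compCoord n A ∈ V at hA
  suffices ∀ x ∈ V, ∃ p, MvPolynomial.eval x p ≠ 0 ∧ ∀ y, MvPolynomial.eval y p ≠ 0 → y ∈ V by
    obtain ⟨p, hp, h⟩ := this _ hA
    exact ⟨p, hp, fun B => h _⟩
  clear hA
  induction hV with
  | basic s hs =>
    obtain ⟨p, rfl⟩ := hs
    exact fun x hx => ⟨p, hx, fun y hy => hy⟩
  | univ => exact fun x _ => ⟨1, by simp, fun _ _ => trivial⟩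
  | inter s t _ _ ihs iht =>
    rintro x ⟨hxs, hxt⟩
    obtain ⟨p, hp, hps⟩ := ihs x hxs
    obtain ⟨q, hq, hqt⟩ := iht x hxt
    refine ⟨p * q, by simp [hp, hq], fun y hy => ?_⟩
    rw [map_mul] at hy
    exact ⟨hps y (left_ne_zero_of_mul hy), hqt y (right_ne_zero_of_mul hy)⟩
  | sUnion S _ ih =>
    rintro x ⟨s, hs, hx⟩
    obtain ⟨p, hp, h⟩ := ih s hs x hx
    exact ⟨p, hp, fun y hy => ⟨s, hs, h y hy⟩⟩

theorem isOpen_le_rank (i : ZMod l) (s : ℕ) :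
    IsOpen[compTopology K n] {A | s ≤ (A i).rank} := by
  let _ := compTopology K n
  have : {A : CompSpace K n | s ≤ (A i).rank} =
      ⋃ (P : Matrix (Fin s) (Fin (n (i + 1))) K) (Q : Matrix (Fin (n i)) (Fin s) K),
        {A | (P * A i * Q).det ≠ 0} := by
    ext A
    simp [Matrix.le_rank_iff_exists_det_ne_zero]
  rw [this]
  refine isOpen_iUnion fun P => isOpen_iUnion fun Q => ?_
  let C : K →+* MvPolynomial (Σ i : ZMod l, Fin (n (i + 1)) × Fin (n i)) K := MvPolynomial.C
  let M : Matrix (Fin (n (i + 1))) (Fin (n i))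
      (MvPolynomial (Σ i : ZMod l, Fin (n (i + 1)) × Fin (n i)) K) :=
    Matrix.of fun a b => MvPolynomial.X ⟨i, a, b⟩
  convert isOpen_eval_compCoord_ne_zero (Matrix.det (P.map C * M * Q.map C)) using 4 with A
  rw [RingHom.map_det, RingHom.mapMatrix_apply, Matrix.map_mul, Matrix.map_mul]
  congr 3 <;> ext <;> simp [compCoord, M, C]

theorem isClosed_comp : IsClosed[compTopology K n] (Comp K n) := by
  let _ := compTopology K n
  have : (Comp K n)ᶜ = ⋃ (i : ZMod l) (a : Fin (n (i + 1 + 1))) (b : Fin (n i)),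
      {A : CompSpace K n | (A (i + 1) * A i) a b ≠ 0} := by
    ext A
    simp [Comp, ← Matrix.ext_iff]
  rw [← isOpen_compl_iff, this]
  refine isOpen_iUnion fun i => isOpen_iUnion fun a => isOpen_iUnion fun b => ?_
  convert isOpen_eval_compCoord_ne_zero (∑ c : Fin (n (i + 1)),
    MvPolynomial.X ⟨i + 1, a, c⟩ * MvPolynomial.X ⟨i, c, b⟩ :
      MvPolynomial (Σ i : ZMod l, Fin (n (i + 1)) × Fin (n i)) K) using 4 with A
  simp [compCoord, Matrix.mul_apply]

theorem isClosed_compR : IsClosed[compTopology K n] (CompR K n r) := by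
  let _ := compTopology K n
  have : CompR K n r = Comp K n ∩ ⋂ i, {A | r i + 1 ≤ (A i).rank}ᶜ := by
    ext A
    simp [CompR]
  rw [this]
  exact isClosed_comp.inter (isClosed_iInter fun i => (isOpen_le_rank i _).isClosed_compl)

theorem IsRankSeq.add_le (hr : IsRankSeq K n r) (i : ZMod l) : r (i + 1) + r i ≤ n (i + 1) := by
  obtain ⟨A, hA, h⟩ := hr
  simpa [h] using Matrix.rank_add_rank_le_card_of_mul_eq_zero (hA i)

/-- A circular complex whose maps are compatible with idempotents `E` factors through the
ranges of the `E j`; moving it by square matrices keeps it a circular complex of bounded rank. -/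
theorem mul_mul_adjugate_mem_compR {E : ∀ j, Matrix (Fin (n j)) (Fin (n j)) K}
    (hE : ∀ i, (E (i + 1)).rank = r i) {B : CompSpace K n} (hBE : ∀ i, B i * E i = 0)
    (hEB : ∀ i, E (i + 1) * B i = B i) (g : ∀ j, Matrix (Fin (n j)) (Fin (n j)) K) :
    (fun i => g (i + 1) * B i * (g i).adjugate) ∈ CompR K n r := by
  refine ⟨fun i => ?_, fun i => ?_⟩
  · have hB : B (i + 1) * B i = 0 := by
      rw [← hEB i, ← Matrix.mul_assoc, hBE, Matrix.zero_mul]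
    calc g (i + 1 + 1) * B (i + 1) * (g (i + 1)).adjugate * (g (i + 1) * B i * (g i).adjugate)
        = g (i + 1 + 1) * (B (i + 1) * ((g (i + 1)).adjugate * g (i + 1)) * B i) *
          (g i).adjugate := by simp only [Matrix.mul_assoc]
      _ = 0 := by simp [adjugate_mul, hB]
  · calc (g (i + 1) * B i * (g i).adjugate).rank
        ≤ (g (i + 1) * B i).rank := rank_mul_le_left _ _
      _ ≤ (B i).rank := rank_mul_le_right _ _
      _ = (E (i + 1) * B i).rank := by rw [hEB]
      _ ≤ (E (i + 1)).rank := rank_mul_le_left _ _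
      _ = r i := hE i

theorem exists_eq_mul_mul_adjugate (hr : IsRankSeq K n r)
    {E : ∀ j, Matrix (Fin (n j)) (Fin (n j)) K} (hEE : ∀ i, E (i + 1) * E (i + 1) = E (i + 1))
    (hE : ∀ i, (E (i + 1)).rank = r i) {A : CompSpace K n} (hA : A ∈ CompR K n r) :
    ∃ (g : ∀ j, Matrix (Fin (n j)) (Fin (n j)) K) (B : CompSpace K n),
      (∀ i, B i * E i = 0) ∧ (∀ i, E (i + 1) * B i = B i) ∧
      ∀ i, A i = g (i + 1) * B i * (g i).adjugate := by
  obtain ⟨g, hg⟩ := exists_forall_add_one (α := fun j => Matrix (Fin (n j)) (Fin (n j)) K)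
    fun i => Matrix.exists_conj_idempotent (hA.1 i) (hEE i)
    ((hA.2 i).trans (hE i).ge)
    ((add_le_add (hA.2 (i + 1)) (hE i).le).trans (hr.add_le i))
  have hdet : ∀ j, (g j).det ≠ 0 := fun j => by
    obtain ⟨i, rfl⟩ : ∃ i, j = i + 1 := ⟨j - 1, by ring⟩
    exact (hg i).1
  have hker : ∀ j, A j * g j * E j = 0 := fun j => by
    obtain ⟨i, rfl⟩ : ∃ i, j = i + 1 := ⟨j - 1, by ring⟩
    exact (hg i).2.1
  refine ⟨g, fun i => (g i).det⁻¹ • ((g (i + 1))⁻¹ * A i * g i), fun i => ?_, fun i => ?_,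
    fun i => ?_⟩
  · rw [Matrix.smul_mul, Matrix.mul_assoc, Matrix.mul_assoc, ← Matrix.mul_assoc (A i), hker,
      Matrix.mul_zero, smul_zero]
  · rw [Matrix.mul_smul, ← Matrix.mul_assoc, ← Matrix.mul_assoc, (hg i).2.2]
  · have hu : IsUnit (g (i + 1)).det := (hdet _).isUnit
    calc A i = (g i).det⁻¹ • (g i).det • A i := (inv_smul_smul₀ (hdet i) _).symm
      _ = (g i).det⁻¹ • (g (i + 1) * (g (i + 1))⁻¹ * A i * (g i * (g i).adjugate)) := by
        rw [mul_nonsing_inv _ hu, mul_adjugate]; simp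
      _ = _ := by simp only [Matrix.mul_assoc, Matrix.smul_mul, Matrix.mul_smul]

/-- Any two points of `Comp(n, r)` lie on a polynomially parametrized curve in `Comp(n, r)`. -/
theorem exists_polynomial_curve (hr : IsRankSeq K n r) {A A' : CompSpace K n}
    (hA : A ∈ CompR K n r) (hA' : A' ∈ CompR K n r) :
    ∃ Γ : ∀ i, Matrix (Fin (n (i + 1))) (Fin (n i)) (Polynomial K),
      (∀ t, (fun i => (Γ i).map (Polynomial.eval t)) ∈ CompR K n r) ∧
      (∀ i, (Γ i).map (Polynomial.eval 0) = A i) ∧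
      ∀ i, (Γ i).map (Polynomial.eval 1) = A' i := by
  obtain ⟨E, hE⟩ := exists_forall_add_one (α := fun j => Matrix (Fin (n j)) (Fin (n j)) K)
    fun i => Matrix.exists_idempotent_rank_eq (K := K) (le_of_add_le_right (hr.add_le i))
  obtain ⟨g, B, hBE, hEB, hAB⟩ :=
    exists_eq_mul_mul_adjugate hr (fun i => (hE i).1) (fun i => (hE i).2) hA
  obtain ⟨g', B', hBE', hEB', hAB'⟩ :=
    exists_eq_mul_mul_adjugate hr (fun i => (hE i).1) (fun i => (hE i).2) hA'
  let line {a b : ℕ} (M M' : Matrix (Fin a) (Fin b) K) : Matrix (Fin a) (Fin b) (Polynomial K) :=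
    M.map Polynomial.C + (Polynomial.X : Polynomial K) • (M' - M).map Polynomial.C
  have hline {a b : ℕ} (M M' : Matrix (Fin a) (Fin b) K) (t : K) :
      (line M M').map (Polynomial.evalRingHom t) = M + t • (M' - M) := by
    ext; simp [line]
  let Γ : ∀ i, Matrix (Fin (n (i + 1))) (Fin (n i)) (Polynomial K) := fun i =>
    line (g (i + 1)) (g' (i + 1)) * line (B i) (B' i) * (line (g i) (g' i)).adjugate
  have hΓ (i) (t : K) : (Γ i).map (Polynomial.eval t) =
      (g (i + 1) + t • (g' (i + 1) - g (i + 1))) * (B i + t • (B' i - B i)) *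
        (g i + t • (g' i - g i)).adjugate := by
    rw [← hline, ← hline, ← hline, ← RingHom.mapMatrix_apply _ (line (g i) (g' i)),
      ← RingHom.map_adjugate, RingHom.mapMatrix_apply, ← Matrix.map_mul, ← Matrix.map_mul]
    rfl
  refine ⟨Γ, fun t => ?_, fun i => ?_, fun i => ?_⟩
  · simp only [hΓ]
    refine mul_mul_adjugate_mem_compR (fun i => (hE i).2) (B := fun i => B i + t • (B' i - B i))
      (fun i => ?_) (fun i => ?_) fun j => g j + t • (g' j - g j)
    · simp [Matrix.add_mul, Matrix.sub_mul, hBE, hBE']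
    · simp [Matrix.mul_add, Matrix.mul_sub, hEB, hEB']
  · simp [hΓ, hAB]
  · simp [hΓ, hAB']

theorem eval_compCoord_map_eval
    (p : MvPolynomial (Σ i : ZMod l, Fin (n (i + 1)) × Fin (n i)) K)
    (Γ : ∀ i, Matrix (Fin (n (i + 1))) (Fin (n i)) (Polynomial K)) (t : K) :
    MvPolynomial.eval (compCoord n fun i => (Γ i).map (Polynomial.eval t)) p =
      (MvPolynomial.aeval (fun q => Γ q.1 q.2.1 q.2.2) p).eval t := by
  induction p using MvPolynomial.induction_on with
  | C a => simp
  | add p q hp hq => simp [hp, hq]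
  | mul_X p q hp => simp [hp, compCoord]

theorem isPreirreducible_compR [Infinite K] (hr : IsRankSeq K n r) :
    @IsPreirreducible _ (compTopology K n) (CompR K n r) := by
  rintro U V hU hV ⟨A, hA, hAU⟩ ⟨A', hA', hAV⟩
  obtain ⟨p, hp, hpU⟩ := exists_eval_compCoord_ne_zero hU hAU
  obtain ⟨q, hq, hqV⟩ := exists_eval_compCoord_ne_zero hV hAV
  obtain ⟨Γ, hΓ, hΓ₀, hΓ₁⟩ := exists_polynomial_curve hr hA hA'
  rw [← funext hΓ₀, eval_compCoord_map_eval] at hp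
  rw [← funext hΓ₁, eval_compCoord_map_eval] at hq
  have hpq := mul_ne_zero
    (ne_of_apply_ne (Polynomial.eval 0) (hp.trans_eq Polynomial.eval_zero.symm))
    (ne_of_apply_ne (Polynomial.eval 1) (hq.trans_eq Polynomial.eval_zero.symm))
  obtain ⟨t, ht⟩ := Polynomial.exists_eval_ne_zero hpq
  rw [Polynomial.eval_mul, ← eval_compCoord_map_eval, ← eval_compCoord_map_eval] at ht
  exact ⟨_, hΓ t, hpU _ (left_ne_zero_of_mul ht), hqV _ (right_ne_zero_of_mul ht)⟩

theorem compR_subset_closure_comp0 [Infinite K] [NeZero l] (hr : IsRankSeq K n r) :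
    CompR K n r ⊆ @closure _ (compTopology K n) (Comp0 K n r) := by
  let _ := compTopology K n
  obtain ⟨A', hA', hrA'⟩ := hr
  intro A hA
  rw [mem_closure_iff]
  intro U hU hAU
  obtain ⟨B, hB, hBU, hBr⟩ := isPreirreducible_compR ⟨A', hA', hrA'⟩ U
    (⋂ i, {A | r i ≤ (A i).rank}) hU (isOpen_iInter_of_finite fun i => isOpen_le_rank i _)
    ⟨A, hA, hAU⟩ ⟨A', ⟨hA', fun i => (hrA' i).le⟩, Set.mem_iInter.2 fun i => (hrA' i).ge⟩
  exact ⟨B, hBU, hB.1, fun i => (hB.2 i).antisymm (Set.mem_iInter.1 hBr i)⟩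

end Circular

/-- **Statement 1.** For any rank sequence `r` for `n`, `Comp(n,r)` equals the Zariski
closure of `Comp⁰(n,r)`; in particular `Comp(n,r)` is an irreducible closed
subvariety of `Comp(n)`. -/
theorem CompR_eq_closure_Comp0 {K : Type} [Field K] [IsAlgClosed K] [CharZero K]
    {l : ℕ} [NeZero l] (n : ZMod l → ℕ) (hn : ∀ i, 0 < n i)
    (r : ZMod l → ℕ) (hr : IsRankSeq K n r) :
    letI := compTopology K n
    CompR K n r = closure (Comp0 K n r) ∧
      IsIrreducible (CompR K n r) ∧ IsClosed (CompR K n r) ∧ CompR K n r ⊆ Comp K n := by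
  let _ := compTopology K n
  have hsub : Comp0 K n r ⊆ CompR K n r := fun A hA => ⟨hA.1, fun i => (hA.2 i).le⟩
  refine ⟨(compR_subset_closure_comp0 hr).antisymm (closure_minimal hsub isClosed_compR),
    ⟨?_, isPreirreducible_compR hr⟩, isClosed_compR, fun A hA => hA.1⟩
  obtain ⟨A, hA, hrA⟩ := hr
  exact ⟨A, hsub ⟨hA, hrA⟩⟩
end

section
/- For any rank sequence r for n, the dimension of the variety Comp(n,r) is at most (1/2)·Σ_{i=0}^{l-1} n_i². -/
/-- A finitely generated domain over a field that embeds into the `k`-algebra generated by a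
finite set `S` has Krull dimension at most the cardinality of `S`. -/
theorem ringKrullDim_le_card_of_le_adjoin {k R L : Type} [Field k] [CommRing R]
    [Nontrivial R] [Algebra k R] [Algebra.FiniteType k R] [Field L] [Algebra k L]
    (f : R →ₐ[k] L) (hf : Function.Injective f) (S : Finset L)
    (hS : f.range ≤ Algebra.adjoin k (S : Set L)) :
    ringKrullDim R ≤ S.card := by
  obtain ⟨d, g, hg, hgi⟩ := exists_integral_inj_algHom_of_fg k R
  have hd : d ≤ S.card := by
    have h₁ : f.range ≤ (MvPolynomial.aeval (R := k) ((↑) : S → L)).range := by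
      rw [← Algebra.adjoin_range_eq_range_aeval]
      simpa using hS
    have h₂ := trdeg_le_of_injective
      ((Subalgebra.inclusion h₁).comp (f.rangeRestrict.comp g))
      (fun x y hxy => hg (hf (congrArg Subtype.val hxy)))
    have h₃ := trdeg_le_of_surjective
      (MvPolynomial.aeval (R := k) ((↑) : S → L)).rangeRestrict
      (AlgHom.rangeRestrict_surjective _)
    have h₄ := h₂.trans h₃
    simpa [MvPolynomial.trdeg_of_isDomain] using h₄
  algebraize [g.toRingHom]
  have hstrict : StrictMono
      (PrimeSpectrum.comap (algebraMap (MvPolynomial (Fin d) k) R)) := by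
    intro P Q hPQ
    exact Ideal.IsIntegral.comap_lt_comap (R := MvPolynomial (Fin d) k)
      (I := P.asIdeal) (J := Q.asIdeal) hPQ
  calc ringKrullDim R ≤ ringKrullDim (MvPolynomial (Fin d) k) :=
        Order.krullDim_le_of_strictMono _ hstrict
    _ = d := by simp
    _ ≤ S.card := by exact_mod_cast hd

section Zariski

open MvPolynomial TopologicalSpace

variable {ι K X : Type} [Field K]

theorem isTopologicalBasis_zariskiTopology :
    @IsTopologicalBasis _ (zariskiTopology ι K)
      { U | ∃ p : MvPolynomial ι K, U = { x | eval x p ≠ 0 } } := by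
  let _ := zariskiTopology ι K
  have h := isTopologicalBasis_of_subbasis_of_inter
    (r := { U | ∃ p : MvPolynomial ι K, U = { x | eval x p ≠ 0 } })
    (t := zariskiTopology ι K) rfl (by
      rintro _ ⟨p, rfl⟩ _ ⟨q, rfl⟩
      refine ⟨p * q, ?_⟩
      ext x
      simp)
  rwa [Set.insert_eq_of_mem] at h
  exact ⟨1, by simp⟩

variable [t : TopologicalSpace X] {φ : X → ι → K}

theorem isOpen_eval_ne_zero (hφ : t = (zariskiTopology ι K).induced φ)
    (p : MvPolynomial ι K) : IsOpen { x | eval (φ x) p ≠ 0 } := by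
  subst hφ
  exact ⟨_, .basic _ ⟨p, rfl⟩, rfl⟩

theorem exists_eval_ne_zero_of_notMem (hφ : t = (zariskiTopology ι K).induced φ)
    {Z : Set X} (hZ : IsClosed Z) {x : X} (hx : x ∉ Z) :
    ∃ p ∈ vanishingIdeal K (φ '' Z), eval (φ x) p ≠ 0 := by
  subst hφ
  obtain ⟨U, hU, hUZ⟩ := hZ.isOpen_compl
  have hxU : φ x ∈ U := by
    change x ∈ φ ⁻¹' U
    rw [hUZ]
    exact hx
  let _ := zariskiTopology ι K
  obtain ⟨_, ⟨p, rfl⟩, hp, hpU⟩ :=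
    isTopologicalBasis_zariskiTopology.mem_nhds_iff.1 (hU.mem_nhds hxU)
  refine ⟨p, ?_, hp⟩
  rintro _ ⟨z, hz, rfl⟩
  by_contra hne
  have : z ∈ φ ⁻¹' U := hpU hne
  rw [hUZ] at this
  exact this hz

theorem isPrime_vanishingIdeal_image (hφ : t = (zariskiTopology ι K).induced φ)
    {Z : Set X} (hZ : IsIrreducible Z) : (vanishingIdeal K (φ '' Z)).IsPrime := by
  refine ⟨fun h => ?_, fun {p q} hpq => ?_⟩
  · obtain ⟨z, hz⟩ := hZ.nonempty
    have := (Ideal.eq_top_iff_one _).1 h (φ z) ⟨z, hz, rfl⟩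
    simp at this
  · by_contra! hne
    have aux : ∀ p, p ∉ vanishingIdeal K (φ '' Z) →
        (Z ∩ { x | eval (φ x) p ≠ 0 }).Nonempty := by
      intro p hp
      simpa [Set.Nonempty, mem_vanishingIdeal_iff] using hp
    obtain ⟨z, hz, hzp, hzq⟩ := hZ.isPreirreducible _ _ (isOpen_eval_ne_zero hφ p)
      (isOpen_eval_ne_zero hφ q) (aux p hne.1) (aux q hne.2)
    have := hpq (φ z) ⟨z, hz, rfl⟩
    simp at this
    exact this.elim hzp hzq

/-- If the coordinate rings of all irreducible closed sets in the closure of a subset of affine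
space have Krull dimension at most `N`, so does the subset itself. -/
theorem topologicalKrullDim_le_of_forall_isPrime (hφ : t = (zariskiTopology ι K).induced φ)
    (N : ℕ) (h : ∀ P : Ideal (MvPolynomial ι K), P.IsPrime →
      vanishingIdeal K (Set.range φ) ≤ P → ringKrullDim (MvPolynomial ι K ⧸ P) ≤ N) :
    topologicalKrullDim X ≤ N := by
  rw [topologicalKrullDim, Order.krullDim_eq_iSup_height]
  refine iSup_le fun Z => ?_
  rw [Order.height_eq_krullDim_Iic]
  refine le_trans ?_ (h (vanishingIdeal K (φ '' Z)) (isPrime_vanishingIdeal_image hφ Z.isIrreducible)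
    (vanishingIdeal_anti_mono (Set.image_subset_range _ _)))
  rw [ringKrullDim_quotient]
  let g : Set.Iic Z →
      (PrimeSpectrum.zeroLocus (R := MvPolynomial ι K) (vanishingIdeal K (φ '' Z)))ᵒᵈ :=
    fun Y => OrderDual.toDual ⟨⟨vanishingIdeal K (φ '' Y.1),
      isPrime_vanishingIdeal_image hφ Y.1.isIrreducible⟩,
      vanishingIdeal_anti_mono (Set.image_mono Y.2)⟩
  refine (Order.krullDim_le_of_strictMono g fun Y Y' hY => ?_).trans_eq Order.krullDim_orderDual
  change vanishingIdeal K (φ '' Y'.1) < vanishingIdeal K (φ '' Y.1)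
  obtain ⟨hle, x, hx', hx⟩ := SetLike.lt_iff_le_and_exists.1 (show Y.1 < Y'.1 from hY)
  obtain ⟨p, hp, hpx⟩ := exists_eval_ne_zero_of_notMem hφ Y.1.isClosed hx
  exact SetLike.lt_iff_le_and_exists.2 ⟨vanishingIdeal_anti_mono (Set.image_mono hle), p, hp,
    fun hp' => hpx (hp' _ ⟨x, hx', rfl⟩)⟩

end Zariski

/-- A finite family of vectors has a basis of its span among its members; if the members indexed
by `T` already span, the basis can be chosen there. -/
theorem exists_finset_card_eq_finrank_span {L V ι : Type} [Field L] [AddCommGroup V] [Module L V]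
    [Fintype ι] (v : ι → V) (T : Finset ι) (hT : ∀ i, v i ∈ Submodule.span L (v '' T)) :
    ∃ I ⊆ T, LinearIndepOn L v I ∧ I.card = Module.finrank L (Submodule.span L (Set.range v)) ∧
      ∃ P : ι → ι → L, ∀ i, v i = ∑ j ∈ I, P i j • v j := by
  classical
  obtain ⟨b, hbT, -, hspan, hb⟩ := exists_linearIndepOn_extension (linearIndepOn_empty L v)
    (Set.empty_subset (T : Set ι))
  obtain ⟨I, rfl⟩ : ∃ I : Finset ι, (I : Set ι) = b := ⟨b.toFinite.toFinset, by simp⟩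
  have hmem : ∀ i, v i ∈ Submodule.span L (v '' I) := fun i =>
    Submodule.span_le.2 hspan (hT i)
  refine ⟨I, by exact_mod_cast hbT, hb, ?_, ?_⟩
  · have hrange : Submodule.span L (Set.range v) = Submodule.span L (v '' I) :=
      le_antisymm (Submodule.span_le.2 (by rintro _ ⟨i, rfl⟩; exact hmem i))
        (Submodule.span_mono (Set.image_subset_range _ _))
    have himage : v '' I = Set.range (fun i : I => v i) := by
      rw [Set.image_eq_range]; rfl
    rw [hrange, himage, ← Fintype.card_coe I]
    exact (finrank_span_eq_card hb).symm
  · choose P hP using fun i => 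
      (Submodule.mem_span_image_finset_iff_exists_fun' L).1 (hmem i)
    exact ⟨P, fun i => (hP i).symm⟩

/-- The entries of a circular complex over an extension `L` of `K` all lie in a `K`-subalgebra
generated by at most `(1/2) ∑ n_i²` elements. -/
theorem exists_finset_entries_mem_adjoin {K L : Type} [Field K] [Field L] [Algebra K L]
    {l : ℕ} [NeZero l] (n : ZMod l → ℕ) (A : CompSpace L n) (hA : A ∈ Comp L n) :
    ∃ S : Finset L, 2 * S.card ≤ ∑ i, n i ^ 2 ∧
      ∀ i a b, A i a b ∈ Algebra.adjoin K (S : Set L) := by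
  classical
  choose I _ hIli hIcard P hP using fun i =>
    exists_finset_card_eq_finrank_span (L := L) (A i).row Finset.univ
      (fun j => Submodule.subset_span ⟨j, by simp, rfl⟩)
  simp only [← Matrix.rank_eq_finrank_span_row] at hIcard
  have hP' : ∀ i a b, A i a b = ∑ k ∈ I i, P i a k * A i k b := fun i a b => by
    simpa [Matrix.row] using congrFun (hP i a) b
  -- the exactness relations, expressed on columns
  have hrel : ∀ i, ∀ k ∈ I i, ∀ a, ∑ b, A (i + 1) a b * P i b k = 0 := by
    intro i k hk a
    have h : ∑ k ∈ I i, (∑ b, A (i + 1) a b * P i b k) • (A i).row k = 0 := by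
      ext c
      have h0 : ∑ b, A (i + 1) a b * A i b c = 0 := by
        simpa [Matrix.mul_apply] using congrFun (congrFun (hA i) a) c
      simp only [Finset.sum_apply, Pi.smul_apply, smul_eq_mul, Finset.sum_mul, Matrix.row]
      rw [Finset.sum_comm, Pi.zero_apply, ← h0]
      refine Finset.sum_congr rfl fun b _ => ?_
      rw [hP' i b c, Finset.mul_sum]
      simp [mul_assoc]
    exact linearIndepOn_finset_iff.1 (hIli i) _ h k hk
  have hPone : ∀ i, ∀ k ∈ I i, ∀ k' ∈ I i, P i k' k = if k' = k then 1 else 0 := by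
    intro i k hk k' hk'
    have h : ∑ k ∈ I i, (P i k' k - if k' = k then 1 else 0) • (A i).row k = 0 := by
      simp only [sub_smul, Finset.sum_sub_distrib, ← hP i k']
      simp [hk']
    exact sub_eq_zero.1 (linearIndepOn_finset_iff.1 (hIli i) _ h k hk)
  have hcol : ∀ i, ∀ k ∈ I i, ∀ a,
      A (i + 1) a k = -∑ b ∈ (I i)ᶜ, A (i + 1) a b * P i b k := by
    intro i k hk a
    have h := hrel i k hk a
    rw [← Finset.sum_add_sum_compl (I i), Finset.sum_congr rfl (fun b hb => by
      rw [hPone i k hk b hb])] at h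
    simp only [mul_ite, mul_one, mul_zero, Finset.sum_ite_eq', hk, if_true] at h
    exact eq_neg_of_add_eq_zero_left h
  choose J hJI hJli hJcard Q hQ using fun i =>
    exists_finset_card_eq_finrank_span (L := L) (A (i + 1)).col (I i)ᶜ (by
      intro k
      by_cases hk : k ∈ I i
      · have : (A (i + 1)).col k = -∑ b ∈ (I i)ᶜ, P i b k • (A (i + 1)).col b := by
          ext a
          simp [Matrix.col, hcol i k hk a, mul_comm]
        rw [this]
        exact neg_mem (Submodule.sum_mem _ fun b hb =>
          Submodule.smul_mem _ _ (Submodule.subset_span ⟨b, hb, rfl⟩))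
      · exact Submodule.subset_span ⟨k, by simpa using hk, rfl⟩)
  simp only [← Matrix.rank_eq_finrank_span_cols] at hJcard
  have hQ' : ∀ i a b, A (i + 1) a b = ∑ j ∈ J i, Q i b j * A (i + 1) a j := fun i a b => by
    simpa [Matrix.col] using congrFun (hQ i b) a
  let S₁ : ZMod l → Finset L := fun i => ((I i)ᶜ ×ˢ I i).image fun q => P i q.1 q.2
  let S₂ : ZMod l → Finset L := fun i => ((I i ∪ J i)ᶜ ×ˢ J i).image fun q => Q i q.1 q.2
  let S₃ : ZMod l → Finset L := fun i =>
    (I (i + 1) ×ˢ J i).image fun q => A (i + 1) q.1 q.2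
  let S : Finset L := Finset.univ.biUnion fun i => S₁ i ∪ (S₂ i ∪ S₃ i)
  have hmem : ∀ i, ∀ x ∈ S₁ i ∪ (S₂ i ∪ S₃ i), x ∈ Algebra.adjoin K (S : Set L) := by
    intro i x hx
    exact Algebra.subset_adjoin (Finset.mem_coe.2 (Finset.mem_biUnion.2 ⟨i, Finset.mem_univ _, hx⟩))
  have hPmem : ∀ i, ∀ a ∉ I i, ∀ k ∈ I i, P i a k ∈ Algebra.adjoin K (S : Set L) :=
    fun i a ha k hk => hmem i _ (Finset.mem_union_left _
      (Finset.mem_image.2 ⟨(a, k), by simp [ha, hk], rfl⟩))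
  have hQmem : ∀ i, ∀ b ∉ I i, b ∉ J i → ∀ j ∈ J i, Q i b j ∈ Algebra.adjoin K (S : Set L) :=
    fun i b hb hb' j hj => hmem i _ (Finset.mem_union_right _ (Finset.mem_union_left _
      (Finset.mem_image.2 ⟨(b, j), by simp [hb, hb', hj], rfl⟩)))
  have hBmem : ∀ i, ∀ a ∈ I (i + 1), ∀ j ∈ J i,
      A (i + 1) a j ∈ Algebra.adjoin K (S : Set L) :=
    fun i a ha j hj => hmem i _ (Finset.mem_union_right _ (Finset.mem_union_right _
      (Finset.mem_image.2 ⟨(a, j), by simp [ha, hj], rfl⟩)))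
  have hJmem : ∀ i a, ∀ j ∈ J i, A (i + 1) a j ∈ Algebra.adjoin K (S : Set L) := by
    intro i a j hj
    by_cases ha : a ∈ I (i + 1)
    · exact hBmem i a ha j hj
    · rw [hP' (i + 1) a j]
      exact sum_mem fun k hk => mul_mem (hPmem _ a ha k hk) (hBmem i k hk j hj)
  have hImem : ∀ i a, ∀ b ∉ I i, A (i + 1) a b ∈ Algebra.adjoin K (S : Set L) := by
    intro i a b hb
    by_cases hb' : b ∈ J i
    · exact hJmem i a b hb'
    · rw [hQ' i a b]
      exact sum_mem fun j hj => mul_mem (hQmem i b hb hb' j hj) (hJmem i a j hj)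
  refine ⟨S, ?_, fun i => ?_⟩
  · have hdisj : ∀ i, (I i ∪ J i).card = (A i).rank + (A (i + 1)).rank := fun i => by
      rw [Finset.card_union_of_disjoint, hIcard, hJcard]
      exact Finset.disjoint_left.2 fun x hx hx' => by simpa [hx] using hJI i hx'
    have hcard : ∀ i, 2 * ((S₁ i ∪ (S₂ i ∪ S₃ i)).card : ℤ) ≤
        (n (i + 1) : ℤ) ^ 2 + (((A (i + 1)).rank : ℤ) ^ 2 - ((A i).rank : ℤ) ^ 2) := by
      intro i
      have h₁ : (S₁ i).card ≤ (n (i + 1) - (A i).rank) * (A i).rank :=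
        Finset.card_image_le.trans (by simp [Finset.card_product, Finset.card_compl, hIcard])
      have h₂ : (S₂ i).card ≤
          (n (i + 1) - ((A i).rank + (A (i + 1)).rank)) * (A (i + 1)).rank :=
        Finset.card_image_le.trans (by
          rw [Finset.card_product, Finset.card_compl, hdisj, hJcard, Fintype.card_fin])
      have h₃ : (S₃ i).card ≤ (A (i + 1)).rank * (A (i + 1)).rank :=
        Finset.card_image_le.trans (by simp [Finset.card_product, hIcard, hJcard])
      have hle : (A i).rank + (A (i + 1)).rank ≤ n (i + 1) := by
        rw [← hdisj]
        simpa using Finset.card_le_univ (I i ∪ J i)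
      have h₄ := Finset.card_union_le (S₁ i) (S₂ i ∪ S₃ i)
      have h₅ := Finset.card_union_le (S₂ i) (S₃ i)
      zify [hle, (Nat.le_add_right _ _).trans hle] at h₁ h₂ h₃ h₄ h₅
      nlinarith [sq_nonneg ((n (i + 1) : ℤ) - (A i).rank - (A (i + 1)).rank)]
    have hshift : ∀ f : ZMod l → ℤ, ∑ i, f (i + 1) = ∑ i, f i := fun f =>
      Equiv.sum_comp (Equiv.addRight (1 : ZMod l)) f
    have hS : (S.card : ℤ) ≤ ∑ i, ((S₁ i ∪ (S₂ i ∪ S₃ i)).card : ℤ) := by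
      exact_mod_cast Finset.card_biUnion_le
    zify
    calc 2 * (S.card : ℤ) ≤ ∑ i, 2 * ((S₁ i ∪ (S₂ i ∪ S₃ i)).card : ℤ) := by
          rw [← Finset.mul_sum]; linarith
      _ ≤ _ := Finset.sum_le_sum fun i _ => hcard i
      _ = ∑ i, (n i : ℤ) ^ 2 := by
          rw [Finset.sum_add_distrib, Finset.sum_sub_distrib,
            hshift fun i => (n i : ℤ) ^ 2, hshift fun i => ((A i).rank : ℤ) ^ 2]
          ring
  · obtain ⟨i, rfl⟩ : ∃ j, j + 1 = i := ⟨i - 1, by simp⟩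
    intro a b
    by_cases hb : b ∈ I i
    · rw [hcol i b hb a]
      refine neg_mem (sum_mem fun b' hb' => ?_)
      have hb'' : b' ∉ I i := by simpa using hb'
      exact mul_mem (hImem i a b' hb'') (hPmem i b' hb'' b hb)
    · exact hImem i a b hb

/-- **Statement 4.** For any rank sequence `r` for `n`, the dimension of `Comp(n,r)`
is at most `(1/2) ∑ n_i²` (stated equivalently, without fractions, as
`dim + dim ≤ ∑ n_i²`).  The dimension is the topological Krull dimension of
`Comp(n,r)` with its Zariski topology. -/
theorem dim_CompR_le {K : Type} [Field K] [IsAlgClosed K] [CharZero K]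
    {l : ℕ} [NeZero l] (n : ZMod l → ℕ) (hn : ∀ i, 0 < n i)
    (r : ZMod l → ℕ) (hr : IsRankSeq K n r) :
    letI := compTopology K n
    topologicalKrullDim (CompR K n r) + topologicalKrullDim (CompR K n r) ≤
      ((∑ i : ZMod l, (n i) ^ 2 : ℕ) : WithBot ℕ∞) := by
  let _ := compTopology K n
  suffices h : topologicalKrullDim (CompR K n r) ≤ (((∑ i, n i ^ 2) / 2 : ℕ) : WithBot ℕ∞) by
    refine (add_le_add h h).trans ?_
    have : (∑ i, n i ^ 2) / 2 + (∑ i, n i ^ 2) / 2 ≤ ∑ i, n i ^ 2 := by omega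
    exact_mod_cast this
  refine topologicalKrullDim_le_of_forall_isPrime
    (φ := fun A : CompR K n r => compCoord n A.1) induced_compose _ fun P hP hle => ?_
  let R := MvPolynomial (Σ i : ZMod l, Fin (n (i + 1)) × Fin (n i)) K ⧸ P
  let L := FractionRing R
  let f : R →ₐ[K] L := IsScalarTower.toAlgHom K R L
  let A : CompSpace L n := fun i a b => f (Ideal.Quotient.mkₐ K P (MvPolynomial.X ⟨i, a, b⟩))
  have hA : A ∈ Comp L n := by
    intro i
    ext a c
    have hmem : ∑ b, (MvPolynomial.X ⟨i + 1, a, b⟩ * MvPolynomial.X ⟨i, b, c⟩ :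
        MvPolynomial (Σ i : ZMod l, Fin (n (i + 1)) × Fin (n i)) K) ∈ P := by
      refine hle ?_
      rintro _ ⟨B, rfl⟩
      have := congrFun (congrFun (B.2.1 i) a) c
      simpa [Matrix.mul_apply, compCoord] using this
    have h0 := congrArg f ((Ideal.Quotient.eq_zero_iff_mem).2 hmem)
    rw [Matrix.mul_apply]
    simpa [A] using h0
  obtain ⟨S, hScard, hS⟩ := exists_finset_entries_mem_adjoin (K := K) n A hA
  have hdim : ringKrullDim R ≤ S.card := by
    refine ringKrullDim_le_card_of_le_adjoin f (IsFractionRing.injective R L) S ?_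
    have hcomp : (f.comp (Ideal.Quotient.mkₐ K P)).range ≤ Algebra.adjoin K (S : Set L) := by
      rw [← Algebra.map_top, ← MvPolynomial.adjoin_range_X, AlgHom.map_adjoin,
        Algebra.adjoin_le_iff]
      rintro _ ⟨_, ⟨⟨i, a, b⟩, rfl⟩, rfl⟩
      exact hS i a b
    rintro _ ⟨x, rfl⟩
    obtain ⟨x, rfl⟩ := Ideal.Quotient.mk_surjective x
    exact hcomp ⟨x, rfl⟩
  refine hdim.trans ?_
  have : S.card ≤ (∑ i, n i ^ 2) / 2 := by omega
  exact_mod_cast this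
end

section
/- Two points (A_i)_{i∈Z/lZ} and (B_i)_{i∈Z/lZ} of Comp(n) lie in the same GL(n)-orbit (i.e. there exist g_i ∈ GL(n_i,K) with B_i = g_{i+1} A_i g_i^{-1} for all i) if and only if rank A_i = rank B_i for all i ∈ Z/lZ. Equivalently, every point of Comp(n) is determined up to GL(n)-equivalence by its dimension vector n and its rank sequence (rank A_i)_{i∈Z/lZ}. -/
namespace LinearMap

variable {K R V U : Type*} [Field K] [AddCommGroup R] [Module K R] [AddCommGroup V] [Module K V]
  [AddCommGroup U] [Module K U]

/-- Injections of a space into two finite-dimensional spaces of the same dimension are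
intertwined by a linear equivalence. -/
theorem exists_linearEquiv_comp_eq [FiniteDimensional K V] [FiniteDimensional K U]
    (h : Module.finrank K V = Module.finrank K U) (i : R →ₗ[K] V) (j : R →ₗ[K] U)
    (hi : Function.Injective i) (hj : Function.Injective j) :
    ∃ θ : V ≃ₗ[K] U, ∀ x, θ (i x) = j x := by
  let e : V ≃ₗ[K] U := LinearEquiv.ofFinrankEq V U h
  let ι : R →ₗ[K] V := e.symm.toLinearMap ∘ₗ j
  have hι : Function.Injective ι := e.symm.injective.comp hj
  obtain ⟨g, hg⟩ := Submodule.exists_linearEquiv_restrict_eq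
    ((LinearEquiv.ofInjective i hi).symm ≪≫ₗ LinearEquiv.ofInjective ι hι)
  refine ⟨g ≪≫ₗ e, fun x => ?_⟩
  have hx := hg (LinearEquiv.ofInjective i hi x)
  simp only [LinearEquiv.trans_apply, LinearEquiv.symm_apply_apply,
    LinearEquiv.ofInjective_apply] at hx
  simp [← hx, ι]

/-- If `i`, `j` are injections into the kernels of `a`, `b`, and `χ` identifies the ranges of `a` and
`b`, then some automorphism of the source carries `i` to `j` and induces `χ`. -/
theorem exists_linearEquiv_extending [FiniteDimensional K V] (i j : R →ₗ[K] V)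
    (hi : Function.Injective i) (hj : Function.Injective j) (a b : V →ₗ[K] U)
    (hai : ∀ x, a (i x) = 0) (hbj : ∀ x, b (j x) = 0) (χ : range a ≃ₗ[K] range b) :
    ∃ g : V ≃ₗ[K] V, (∀ x, g (i x) = j x) ∧ ∀ v, b (g v) = χ (a.rangeRestrict v) := by
  have hker : Module.finrank K (ker a) = Module.finrank K (ker b) := by
    have ha := a.finrank_range_add_finrank_ker
    have hb := b.finrank_range_add_finrank_ker
    have := χ.finrank_eq
    omega
  obtain ⟨θ, hθ⟩ := exists_linearEquiv_comp_eq hker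
    (i.codRestrict (ker a) hai) (j.codRestrict (ker b) hbj)
    (fun x y h => hi (congrArg Subtype.val h)) (fun x y h => hj (congrArg Subtype.val h))
  obtain ⟨s, hs⟩ := b.rangeRestrict.exists_rightInverse_of_surjective b.range_rangeRestrict
  obtain ⟨p, hp⟩ := (ker a).subtype.exists_leftInverse_of_injective (ker a).ker_subtype
  have hs' (y : range b) : b (s y) = y := congrArg Subtype.val (LinearMap.congr_fun hs y)
  have hp' (x : ker a) : p x = x := LinearMap.congr_fun hp x
  let g : V →ₗ[K] V :=
    (ker b).subtype ∘ₗ θ.toLinearMap ∘ₗ p + s ∘ₗ χ.toLinearMap ∘ₗ a.rangeRestrict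
  have hg (v : V) : g v = θ (p v) + s (χ (a.rangeRestrict v)) := rfl
  have hbg (v : V) : b (g v) = χ (a.rangeRestrict v) := by
    rw [hg, map_add, hs', mem_ker.1 (θ (p v)).2, zero_add]
  have hgker (x : ker a) : g x = θ x := by
    have : a.rangeRestrict x = 0 := Subtype.ext x.2
    rw [hg, hp', this, map_zero, map_zero, add_zero]
  have hinj : Function.Injective g := by
    rw [← ker_eq_bot, ker_eq_bot']
    intro v hv
    have h0 : a.rangeRestrict v = 0 := by
      apply χ.injective
      apply Subtype.ext
      rw [← hbg, hv, map_zero, map_zero, ZeroMemClass.coe_zero]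
    have hva : v ∈ ker a := congrArg Subtype.val h0
    have h1 := hgker ⟨v, hva⟩
    rw [hv, eq_comm, ZeroMemClass.coe_eq_zero, LinearEquiv.map_eq_zero_iff] at h1
    exact congrArg Subtype.val h1
  refine ⟨LinearEquiv.ofInjectiveEndo g hinj, fun x => ?_, hbg⟩
  exact (hgker (i.codRestrict (ker a) hai x)).trans (congrArg Subtype.val (hθ x))

end LinearMap

/-- Two circular complexes of linear maps whose ranges have equal dimensions are isomorphic. -/
theorem exists_linearEquiv_of_circular {K : Type*} [Field K] {l : ℕ} {V : ZMod l → Type*}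
    [∀ i, AddCommGroup (V i)] [∀ i, Module K (V i)] [∀ i, FiniteDimensional K (V i)]
    (a b : ∀ i, V i →ₗ[K] V (i + 1)) (ha : ∀ i x, a (i + 1) (a i x) = 0)
    (hb : ∀ i x, b (i + 1) (b i x) = 0)
    (h : ∀ i, Module.finrank K (a i).range = Module.finrank K (b i).range) :
    ∃ g : ∀ i, V i ≃ₗ[K] V i, ∀ i x, g (i + 1) (a i x) = b i (g i x) := by
  let χ (i : ZMod l) : (a i).range ≃ₗ[K] (b i).range := LinearEquiv.ofFinrankEq _ _ (h i)
  have key (i : ZMod l) : ∃ g : V (i + 1) ≃ₗ[K] V (i + 1),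
      (∀ x : (a i).range, g x = χ i x) ∧
        ∀ v, b (i + 1) (g v) = χ (i + 1) ((a (i + 1)).rangeRestrict v) := by
    refine LinearMap.exists_linearEquiv_extending (a i).range.subtype
      ((b i).range.subtype ∘ₗ (χ i).toLinearMap) Subtype.val_injective
      (Subtype.val_injective.comp (χ i).injective) _ _ ?_ ?_ _
    · rintro ⟨_, x, rfl⟩
      exact ha i x
    · intro x
      obtain ⟨y, hy⟩ := (χ i x).2
      simp [← hy, hb]
  choose g₀ hg₀ hg₀' using key
  let g : ∀ i, V i ≃ₗ[K] V i :=
    (Equiv.addRight (1 : ZMod l)).piCongrLeft (fun j => V j ≃ₗ[K] V j) g₀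
  have hg (i : ZMod l) : g (i + 1) = g₀ i :=
    (Equiv.addRight (1 : ZMod l)).piCongrLeft_apply_apply (fun j => V j ≃ₗ[K] V j) g₀ i
  have hbg (i : ZMod l) : ∀ v, b i (g i v) = χ i ((a i).rangeRestrict v) := by
    obtain ⟨i, rfl⟩ := (Equiv.addRight (1 : ZMod l)).surjective i
    change ∀ v, b (i + 1) (g (i + 1) v) = _
    rw [hg]
    exact hg₀' i
  refine ⟨g, fun i x => ?_⟩
  rw [hbg, hg]
  exact hg₀ i ((a i).rangeRestrict x)

/-- **Statement 7.** Two points `(A_i)`, `(B_i)` of `Comp(n)` lie in the same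
`GL(n)`-orbit (i.e. `B_i = g_{i+1} A_i g_i⁻¹` for some `g_i ∈ GL(n_i,K)`) if and only
if `rank A_i = rank B_i` for all `i ∈ ℤ/lℤ`. -/
theorem Comp_orbit_iff_rank {K : Type} [Field K] [IsAlgClosed K] [CharZero K]
    {l : ℕ} [NeZero l] (n : ZMod l → ℕ) (hn : ∀ i, 0 < n i)
    (A B : CompSpace K n) (hA : A ∈ Comp K n) (hB : B ∈ Comp K n) :
    (∃ g : ∀ i : ZMod l, GL (Fin (n i)) K,
        ∀ i : ZMod l, B i = (g (i + 1) : Matrix (Fin (n (i + 1))) (Fin (n (i + 1))) K) *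
          A i * (((g i)⁻¹ : GL (Fin (n i)) K) : Matrix (Fin (n i)) (Fin (n i)) K)) ↔
      ∀ i : ZMod l, (A i).rank = (B i).rank := by
  constructor
  · rintro ⟨g, hg⟩ i
    rw [hg i, Matrix.rank_mul_eq_left_of_isUnit_det _ _
        ((Matrix.isUnit_iff_isUnit_det _).1 (g i)⁻¹.isUnit),
      Matrix.rank_mul_eq_right_of_isUnit_det _ _
        ((Matrix.isUnit_iff_isUnit_det _).1 (g (i + 1)).isUnit)]
  · intro h
    obtain ⟨g, hg⟩ := exists_linearEquiv_of_circular (V := fun i => Fin (n i) → K)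
      (fun i => (A i).mulVecLin) (fun i => (B i).mulVecLin)
      (fun i x => by simp [Matrix.mulVec_mulVec, hA i])
      (fun i x => by simp [Matrix.mulVec_mulVec, hB i]) h
    let G (i : ZMod l) : GL (Fin (n i)) K := Matrix.GeneralLinearGroup.toLin.symm
      ((LinearMap.GeneralLinearGroup.generalLinearEquiv K (Fin (n i) → K)).symm (g i))
    have hG (i : ZMod l) (x : Fin (n i) → K) :
        (G i : Matrix (Fin (n i)) (Fin (n i)) K).mulVec x = g i x :=
      LinearMap.toMatrix'_mulVec (g i).toLinearMap x
    refine ⟨G, fun i => ?_⟩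
    have hcomm : B i * (G i : Matrix (Fin (n i)) (Fin (n i)) K) =
        (G (i + 1) : Matrix (Fin (n (i + 1))) (Fin (n (i + 1))) K) * A i := by
      refine Matrix.ext_iff_mulVec.2 fun x => ?_
      rw [← Matrix.mulVec_mulVec, ← Matrix.mulVec_mulVec, hG, hG]
      exact (hg i x).symm
    rw [← hcomm, Matrix.mul_assoc, Units.mul_inv, Matrix.mul_one]
end

section
/- A tuple r = (r_i)_{i∈Z/lZ} of nonnegative integers is a rank sequence for n (i.e. there exists (A_i) ∈ Comp(n) with rank A_i = r_i for all i) if and only if r_{i-1} + r_i ≤ n_i for all i ∈ Z/lZ. -/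
/-- The matrix sending the last `r` basis vectors, in order, to the first `r` basis vectors
and all other basis vectors to zero. -/
def shiftMatrix (K : Type*) [Field K] (m k r : ℕ) : Matrix (Fin m) (Fin k) K :=
  Matrix.of fun p q => if (q : ℕ) = p + (k - r) then 1 else 0

lemma rank_shiftMatrix (K : Type*) [Field K] {m k r : ℕ} (hm : r ≤ m) (hk : r ≤ k) :
    (shiftMatrix K m k r).rank = r := by
  have hspan : Submodule.span K (Set.range (shiftMatrix K m k r).col) =
      Submodule.span K (Set.range fun j : Fin r => (Pi.single (Fin.castLE hm j) 1 : Fin m → K)) := by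
    apply le_antisymm <;> rw [Submodule.span_le]
    · rintro _ ⟨q, rfl⟩
      by_cases hq : k - r ≤ q
      · refine Submodule.subset_span ⟨⟨q - (k - r), by omega⟩, ?_⟩
        ext p
        simp only [shiftMatrix, Matrix.col_apply, Matrix.of_apply, Pi.single_apply, Fin.ext_iff,
          Fin.val_castLE]
        exact if_congr (by omega) rfl rfl
      · have hzero : (shiftMatrix K m k r).col q = 0 := by
          ext p
          simp only [shiftMatrix, Matrix.col_apply, Matrix.of_apply, Pi.zero_apply]
          exact if_neg (by omega)
        rw [hzero]
        exact Submodule.zero_mem _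
    · rintro _ ⟨j, rfl⟩
      refine Submodule.subset_span ⟨⟨j + (k - r), by omega⟩, ?_⟩
      ext p
      simp only [shiftMatrix, Matrix.col_apply, Matrix.of_apply, Pi.single_apply, Fin.ext_iff,
        Fin.val_castLE]
      exact if_congr (by omega) rfl rfl
  have hli : LinearIndependent K
      fun j : Fin r => (Pi.single (Fin.castLE hm j) 1 : Fin m → K) :=
    (Pi.linearIndependent_single_one (Fin m) K).comp _ (Fin.castLE_injective hm)
  rw [Matrix.rank_eq_finrank_span_cols, hspan, finrank_span_eq_card hli, Fintype.card_fin]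

lemma shiftMatrix_mul_shiftMatrix (K : Type*) [Field K] {m k p r s : ℕ} (hm : r ≤ m)
    (h : r + s ≤ k) : shiftMatrix K p k s * shiftMatrix K k m r = 0 := by
  ext a b
  simp only [shiftMatrix, Matrix.mul_apply, Matrix.of_apply, Matrix.zero_apply]
  refine Finset.sum_eq_zero fun c _ => ?_
  split_ifs <;> first | omega | simp

/-- **Statement 8.** A tuple `r` of nonnegative integers is a rank sequence for `n`
(i.e. is realized by some circular complex) if and only if `r_{i-1} + r_i ≤ n_i`
for all `i ∈ ℤ/lℤ`. -/
theorem isRankSeq_iff {K : Type} [Field K] [IsAlgClosed K] [CharZero K]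
    {l : ℕ} [NeZero l] (n : ZMod l → ℕ) (hn : ∀ i, 0 < n i) (r : ZMod l → ℕ) :
    IsRankSeq K n r ↔ ∀ i : ZMod l, r (i - 1) + r i ≤ n i := by
  constructor
  · rintro ⟨A, hA, hr⟩ i
    have h := Matrix.rank_add_rank_le_card_of_mul_eq_zero (hA (i - 1))
    rwa [hr, hr, sub_add_cancel, Fintype.card_fin, add_comm] at h
  · intro h
    have h' (i : ZMod l) : r i + r (i + 1) ≤ n (i + 1) := by
      simpa using h (i + 1)
    have hs (i : ZMod l) : r i ≤ n i := le_of_add_le_right (h i)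
    exact ⟨fun i => shiftMatrix K (n (i + 1)) (n i) (r i),
      fun i => shiftMatrix_mul_shiftMatrix K (hs i) (h' i),
      fun i => rank_shiftMatrix K (le_of_add_le_left (h' i)) (hs i)⟩
end

section
/- Let (Q*,R*) be a complete gentle quiver with relations, Λ = KQ*/⟨R*⟩, and d ∈ Z_{≥0}^{Q*_0} a dimension vector. Then the arrow set Q*_1 is the disjoint union of the arrow sets of the effective oriented cycles of (Q*,R*), and the representation variety rep(Λ,d) is GL(d)-equivariantly isomorphic to the product, over the effective oriented cycles C = a_1…a_n of (Q*,R*), of the varieties of circular complexes Comp((d(t a_j))_j) associated to those cycles. -/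
/-! Framework: gentle and complete gentle quivers with relations.  Since all relations
of a gentle quiver are monomial of length two, the relation set is recorded as a set of
composable pairs of arrows: the pair `(a, b)` stands for the length-two path `a` then
`b` (written `ba` in the composition conventions of the paper). -/

/-- A finite quiver: finite vertex and arrow sets with source and target maps. -/
structure QuiverData where
  V : Type
  A : Type
  [fintypeV : Fintype V]
  [fintypeA : Fintype A]
  [decEqV : DecidableEq V]
  [decEqA : DecidableEq A]
  src : A → V
  tgt : A → V

attribute [instance] QuiverData.fintypeV QuiverData.fintypeA QuiverData.decEqV QuiverData.decEqA

/-- The pairs of arrows `(a, b)` such that the path `a` then `b` makes sense. -/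
def ComposablePairs (Q : QuiverData) : Set (Q.A × Q.A) :=
  { p | Q.tgt p.1 = Q.src p.2 }

/-- (SB1): every vertex has at most two incoming and at most two outgoing arrows. -/
def SB1 (Q : QuiverData) : Prop :=
  ∀ v : Q.V, Fintype.card {a : Q.A // Q.tgt a = v} ≤ 2 ∧
    Fintype.card {a : Q.A // Q.src a = v} ≤ 2

/-- (SB2) for monomial length-two relations: for every arrow `a` there is at most one
arrow `b` such that `a` then `b` avoids the relations, and at most one arrow `c` such
that `c` then `a` avoids the relations. -/
def SB2 (Q : QuiverData) (R : Set (Q.A × Q.A)) : Prop :=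
  ∀ a : Q.A,
    {b : Q.A | Q.tgt a = Q.src b ∧ (a, b) ∉ R}.Subsingleton ∧
    {c : Q.A | Q.tgt c = Q.src a ∧ (c, a) ∉ R}.Subsingleton

/-- (G1): if `a₁ ≠ a₂` are arrows with the same tail and `b` is an arrow with head
that tail, then exactly one of the paths `b`-then-`a₁`, `b`-then-`a₂` is a relation. -/
def G1 (Q : QuiverData) (R : Set (Q.A × Q.A)) : Prop :=
  ∀ a₁ a₂ b : Q.A, a₁ ≠ a₂ → Q.src a₁ = Q.src a₂ → Q.tgt b = Q.src a₁ →
    ((b, a₁) ∈ R ↔ (b, a₂) ∉ R)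

/-- (G2): if `b₁ ≠ b₂` are arrows with the same head and `a` is an arrow with tail
that head, then exactly one of the paths `b₁`-then-`a`, `b₂`-then-`a` is a relation. -/
def G2 (Q : QuiverData) (R : Set (Q.A × Q.A)) : Prop :=
  ∀ b₁ b₂ a : Q.A, b₁ ≠ b₂ → Q.tgt b₁ = Q.tgt b₂ → Q.src a = Q.tgt b₁ →
    ((b₁, a) ∈ R ↔ (b₂, a) ∉ R)

/-- A gentle quiver with relations: (SB1), (SB2), (G1), (G2) hold and all relations
are (composable) length-two monomial relations (G3). -/
def IsGentle (Q : QuiverData) (R : Set (Q.A × Q.A)) : Prop :=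
  R ⊆ ComposablePairs Q ∧ SB1 Q ∧ SB2 Q R ∧ G1 Q R ∧ G2 Q R

/-- A complete gentle quiver with relations: every vertex has exactly two incoming and
exactly two outgoing arrows, and every arrow `a` has exactly one arrow `a'` with
`a`-then-`a'` a relation and exactly one arrow `a''` with `a''`-then-`a` a relation. -/
def IsCompleteGentle (Q : QuiverData) (R : Set (Q.A × Q.A)) : Prop :=
  R ⊆ ComposablePairs Q ∧
    (∀ v : Q.V, Fintype.card {a : Q.A // Q.tgt a = v} = 2 ∧
      Fintype.card {a : Q.A // Q.src a = v} = 2) ∧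
    (∀ a : Q.A, ∃! a' : Q.A, (a, a') ∈ R) ∧
    (∀ a : Q.A, ∃! a'' : Q.A, (a'', a) ∈ R)

/-- The affine space of `d`-dimensional representations of the quiver `Q` (with chosen
bases): a matrix `Mat_{d(ta) × d(sa)}(K)` for each arrow `a`. -/
abbrev RepSpace (K : Type) [Field K] (Q : QuiverData) (d : Q.V → ℕ) : Type :=
  ∀ a : Q.A, Matrix (Fin (d (Q.tgt a))) (Fin (d (Q.src a))) K

/-- Casting matrices along equalities of dimensions. -/
def castMat {K : Type} [Field K] {m n m' n' : ℕ} (h1 : m = m') (h2 : n = n')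
    (M : Matrix (Fin m) (Fin n) K) : Matrix (Fin m') (Fin n') K :=
  M.submatrix (Fin.cast h1.symm) (Fin.cast h2.symm)

/-- The representation variety `rep(Λ, d)` of the algebra `Λ = KQ/⟨R⟩` presented by a
quiver with length-two monomial relations `R`: representations `M` with
`M(b) M(a) = 0` for every relation `a`-then-`b` in `R`. -/
def RepSet (K : Type) [Field K] (Q : QuiverData) (R : Set (Q.A × Q.A)) (d : Q.V → ℕ) :
    Set (RepSpace K Q d) :=
  { M | ∀ p : Q.A × Q.A, p ∈ R → ∀ h : Q.tgt p.1 = Q.src p.2,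
      castMat rfl (congrArg d h.symm) (M p.2) * M p.1 = 0 }

/-- The base change group `GL(d) = ∏_v GL(d(v), K)`. -/
abbrev GLd (K : Type) [Field K] (Q : QuiverData) (d : Q.V → ℕ) : Type :=
  ∀ v : Q.V, GL (Fin (d v)) K

/-- The base change action of `GL(d)` on the representation space. -/
def glAct {K : Type} [Field K] {Q : QuiverData} {d : Q.V → ℕ}
    (g : GLd K Q d) (M : RepSpace K Q d) : RepSpace K Q d :=
  fun a => (g (Q.tgt a) : Matrix (Fin (d (Q.tgt a))) (Fin (d (Q.tgt a))) K) * M a *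
    (((g (Q.src a))⁻¹ : GL (Fin (d (Q.src a))) K) :
      Matrix (Fin (d (Q.src a))) (Fin (d (Q.src a))) K)

/-- An effective oriented cycle of `(Q, R)`: pairwise distinct arrows
`c_0, c_1, …, c_{m-1}` forming an oriented cycle all of whose consecutive length-two
subpaths (including the wrap-around one) are relations in `R`. -/
def IsEffectiveCycle (Q : QuiverData) (R : Set (Q.A × Q.A)) {m : ℕ}
    (c : ZMod m → Q.A) : Prop :=
  0 < m ∧ Function.Injective c ∧
    ∀ i : ZMod m, Q.tgt (c i) = Q.src (c (i + 1)) ∧ (c i, c (i + 1)) ∈ R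

section CastMat

variable {K : Type} [Field K]

theorem castMat_mul_castMat_eq_zero_iff {p p' k k' n : ℕ} (hp : p = p') (hk : k' = k)
    (A : Matrix (Fin p) (Fin k) K) (B : Matrix (Fin k') (Fin n) K) :
    castMat hp rfl A * castMat hk rfl B = 0 ↔ castMat rfl hk.symm A * B = 0 := by
  subst hp hk
  rfl

theorem castMat_injective {m n m' n' : ℕ} (hm : m = m') (hn : n = n') :
    Function.Injective (castMat (K := K) hm hn) := by
  subst hm hn
  exact fun _ _ h => h

theorem castMat_castMat_symm {m n m' : ℕ} (hm : m = m') (A : Matrix (Fin m') (Fin n) K) :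
    castMat hm rfl (castMat hm.symm rfl A) = A := by
  subst hm
  rfl

theorem castMat_gl_mul_mul {V : Type} {d : V → ℕ} (g : ∀ v, GL (Fin (d v)) K) {v w : V}
    (h : v = w) {n : ℕ} (A : Matrix (Fin (d v)) (Fin n) K) (X : Matrix (Fin n) (Fin n) K) :
    castMat (congrArg d h) rfl ((g v : Matrix (Fin (d v)) (Fin (d v)) K) * A * X) =
      (g w : Matrix (Fin (d w)) (Fin (d w)) K) * castMat (congrArg d h) rfl A * X := by
  subst h
  rfl

end CastMat

section CycleMap

variable {α : Type} (σ : Equiv.Perm α) (a : α)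

/-- The parametrization of the `σ`-orbit of `a` by residues modulo its length. -/
noncomputable def cycleMap (i : ZMod (Function.minimalPeriod σ a)) : α :=
  σ^[i.val] a

theorem cycleMap_natCast (n : ℕ) : cycleMap σ a n = σ^[n] a := by
  rw [cycleMap, ZMod.val_natCast, Function.iterate_mod_minimalPeriod_eq]

theorem sameCycle_iterate (n : ℕ) : σ.SameCycle a (σ^[n] a) :=
  ⟨n, by rw [zpow_natCast, Equiv.Perm.iterate_eq_pow]⟩

variable [Finite α]

theorem minimalPeriod_perm_pos : 0 < Function.minimalPeriod σ a :=
  Function.minimalPeriod_pos_of_mem_periodicPts (σ.injective.mem_periodicPts a)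

theorem cycleMap_add_one (i : ZMod (Function.minimalPeriod σ a)) :
    cycleMap σ a (i + 1) = σ (cycleMap σ a i) := by
  have : NeZero (Function.minimalPeriod σ a) := ⟨(minimalPeriod_perm_pos σ a).ne'⟩
  obtain ⟨n, rfl⟩ := ZMod.natCast_zmod_surjective i
  rw [← Nat.cast_succ, cycleMap_natCast, cycleMap_natCast, Function.iterate_succ_apply']

theorem cycleMap_injective : Function.Injective (cycleMap σ a) := by
  have : NeZero (Function.minimalPeriod σ a) := ⟨(minimalPeriod_perm_pos σ a).ne'⟩
  intro i j h
  exact ZMod.val_injective _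
    (Function.iterate_injOn_Iio_minimalPeriod (ZMod.val_lt i) (ZMod.val_lt j) h)

theorem range_cycleMap : Set.range (cycleMap σ a) = {b | σ.SameCycle a b} := by
  ext b
  constructor
  · rintro ⟨i, rfl⟩
    exact sameCycle_iterate σ a _
  · intro h
    obtain ⟨n, rfl⟩ := h.exists_nat_pow_eq
    exact ⟨n, by rw [cycleMap_natCast, Equiv.Perm.iterate_eq_pow]⟩

theorem range_eq_sameCycle_of_add_one {m : ℕ} (hm : 0 < m) {c : ZMod m → α}
    (hc : ∀ i, c (i + 1) = σ (c i)) : Set.range c = {b | σ.SameCycle (c 0) b} := by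
  have : NeZero m := ⟨hm.ne'⟩
  have key (n : ℕ) : c n = σ^[n] (c 0) := by
    induction n with
    | zero => simp
    | succ n ih => rw [Nat.cast_succ, hc, ih, Function.iterate_succ_apply']
  ext b
  constructor
  · rintro ⟨i, rfl⟩
    obtain ⟨n, rfl⟩ := ZMod.natCast_zmod_surjective i
    rw [key]
    exact sameCycle_iterate σ _ n
  · intro h
    obtain ⟨n, rfl⟩ := h.exists_nat_pow_eq
    exact ⟨n, by rw [key, Equiv.Perm.iterate_eq_pow]⟩

theorem bijective_sigma_cycleMap :
    Function.Bijective
      (fun q : Σ j : Quotient (Equiv.Perm.SameCycle.setoid σ),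
        ZMod (Function.minimalPeriod σ j.out) => cycleMap σ q.1.out q.2) := by
  constructor
  · rintro ⟨j, i⟩ ⟨j', i'⟩ h
    have hi : σ^[i.val] j.out = σ^[i'.val] j'.out := h
    have hj : σ.SameCycle j.out j'.out :=
      (hi ▸ sameCycle_iterate σ j.out i.val).trans (sameCycle_iterate σ j'.out i'.val).symm
    obtain rfl : j = j' := Quotient.out_equiv_out.mp hj
    exact congrArg (Sigma.mk j) (cycleMap_injective σ _ h)
  · intro b
    have hb : b ∈ Set.range (cycleMap σ (Quotient.mk (Equiv.Perm.SameCycle.setoid σ) b).out) := by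
      rw [range_cycleMap]
      exact Quotient.mk_out (s := Equiv.Perm.SameCycle.setoid σ) b
    obtain ⟨i, hi⟩ := hb
    exact ⟨⟨_, i⟩, hi⟩

end CycleMap

/-- In a complete gentle quiver, the relations are the graph of a permutation of the arrows. -/
theorem IsCompleteGentle.exists_perm {Q : QuiverData} {R : Set (Q.A × Q.A)}
    (h : IsCompleteGentle Q R) : ∃ σ : Equiv.Perm Q.A, ∀ a b, (a, b) ∈ R ↔ b = σ a := by
  obtain ⟨-, -, hs, hp⟩ := h
  choose s hs hs' using hs
  choose p hp hp' using hp
  exact ⟨⟨s, p, fun a => (hp' _ _ (hs a)).symm, fun a => (hs' _ _ (hp a)).symm⟩,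
    fun a b => ⟨hs' a b, fun h => h ▸ hs a⟩⟩

/-- If effective cycles enumerate the arrows bijectively, reindexing along them identifies
representations with tuples of circular complexes. -/
theorem bijOn_repSet_comp {K : Type} [Field K] {Q : QuiverData} {R : Set (Q.A × Q.A)}
    (d : Q.V → ℕ) {σ : Equiv.Perm Q.A} (hσ : ∀ a b, (a, b) ∈ R ↔ b = σ a)
    {ι : Type} {m : ι → ℕ} {c : ∀ j : ι, ZMod (m j) → Q.A}
    (hcyc : ∀ j : ι, IsEffectiveCycle Q R (c j))
    (hbij : Function.Bijective (fun q : Σ j : ι, ZMod (m j) => c q.1 q.2)) :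
    Set.BijOn
      (fun (M : RepSpace K Q d) (j : ι) (i : ZMod (m j)) =>
        castMat (congrArg d ((hcyc j).2.2 i).1) rfl (M (c j i)))
      (RepSet K Q R d)
      { N : ∀ j : ι, CompSpace K (fun i => d (Q.src (c j i))) |
        ∀ j : ι, N j ∈ Comp K (fun i => d (Q.src (c j i))) } := by
  have mem_iff (M : RepSpace K Q d) : M ∈ RepSet K Q R d ↔
      ∀ j, (fun i => castMat (congrArg d ((hcyc j).2.2 i).1) rfl (M (c j i))) ∈
        Comp K (fun i => d (Q.src (c j i))) := by
    constructor
    · intro hM j i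
      exact (castMat_mul_castMat_eq_zero_iff _ _ _ _).mpr
        (hM _ ((hcyc j).2.2 i).2 ((hcyc j).2.2 i).1)
    · rintro hM ⟨a, b⟩ hab h
      obtain ⟨⟨j, i⟩, rfl⟩ := hbij.2 a
      obtain rfl : b = c j (i + 1) :=
        ((hσ _ _).mp hab).trans ((hσ _ _).mp ((hcyc j).2.2 i).2).symm
      exact (castMat_mul_castMat_eq_zero_iff _ _ _ _).mp (hM j i)
  refine ⟨fun M hM => (mem_iff M).mp hM, fun M _ M' _ h => ?_, fun N hN => ?_⟩
  · funext a
    obtain ⟨⟨j, i⟩, rfl⟩ := hbij.2 a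
    exact castMat_injective _ _ (congrFun (congrFun h j) i)
  · let M : RepSpace K Q d :=
      Equiv.piCongrLeft (fun a => Matrix (Fin (d (Q.tgt a))) (Fin (d (Q.src a))) K)
        (Equiv.ofBijective _ hbij)
        (fun q => castMat (congrArg d ((hcyc q.1).2.2 q.2).1).symm rfl (N q.1 q.2))
    have hM : (fun j i => castMat (congrArg d ((hcyc j).2.2 i).1) rfl (M (c j i))) = N := by
      funext j i
      have : M (c j i) = castMat (congrArg d ((hcyc j).2.2 i).1).symm rfl (N j i) :=
        Equiv.piCongrLeft_apply_apply _ (Equiv.ofBijective _ hbij) _ ⟨j, i⟩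
      rw [this, castMat_castMat_symm]
    exact ⟨M, (mem_iff M).mpr fun j => congrFun hM j ▸ hN j, hM⟩

/-- **Statement 12.** Let `(Q, R)` be a complete gentle quiver with relations,
`Λ = KQ/⟨R⟩`, and `d` a dimension vector.  Then the arrow set of `Q` is the disjoint
union of the arrow sets of the effective oriented cycles of `(Q, R)` (every effective
cycle appears in the list, and the arrows of the listed cycles enumerate `Q₁`
bijectively), and the canonical reindexing map is a `GL(d)`-equivariant isomorphism
from the representation variety `rep(Λ, d)` onto the product, over the effective
cycles `c = a_1 … a_m`, of the varieties of circular complexes `Comp((d(t a_j))_j)`. -/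
theorem repSet_iso_prod_comp (K : Type) [Field K] [IsAlgClosed K] [CharZero K]
    (Q : QuiverData) (R : Set (Q.A × Q.A)) (hcg : IsCompleteGentle Q R) (d : Q.V → ℕ) :
    ∃ (ι : Type) (_ : Fintype ι) (m : ι → ℕ) (c : ∀ j : ι, ZMod (m j) → Q.A)
      (hcyc : ∀ j : ι, IsEffectiveCycle Q R (c j)),
      -- the arrows of the cycles partition the arrow set of `Q`
      Function.Bijective (fun q : Σ j : ι, ZMod (m j) => c q.1 q.2) ∧
      -- the list contains every effective cycle of `(Q,R)` (up to its arrow set)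
      (∀ (m' : ℕ) (c' : ZMod m' → Q.A), IsEffectiveCycle Q R c' →
        ∃ j : ι, Set.range c' = Set.range (c j)) ∧
      -- the reindexing map restricts to a bijection from `rep(Λ,d)` onto the
      -- product of the varieties of circular complexes ...
      Set.BijOn
        (fun (M : RepSpace K Q d) (j : ι) (i : ZMod (m j)) =>
          castMat (congrArg d ((hcyc j).2.2 i).1) rfl (M (c j i)))
        (RepSet K Q R d)
        { N : ∀ j : ι, CompSpace K (fun i => d (Q.src (c j i))) |
          ∀ j : ι, N j ∈ Comp K (fun i => d (Q.src (c j i))) } ∧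
      -- ... and it is `GL(d)`-equivariant
      (∀ (g : GLd K Q d) (M : RepSpace K Q d) (j : ι) (i : ZMod (m j)),
        castMat (congrArg d ((hcyc j).2.2 i).1) rfl (glAct g M (c j i)) =
          (g (Q.src (c j (i + 1))) :
              Matrix (Fin (d (Q.src (c j (i + 1))))) (Fin (d (Q.src (c j (i + 1))))) K) *
            castMat (congrArg d ((hcyc j).2.2 i).1) rfl (M (c j i)) *
            (((g (Q.src (c j i)))⁻¹ : GL (Fin (d (Q.src (c j i)))) K) :
              Matrix (Fin (d (Q.src (c j i)))) (Fin (d (Q.src (c j i)))) K)) := by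
  obtain ⟨σ, hσ⟩ := hcg.exists_perm
  have hcyc (j : Quotient (Equiv.Perm.SameCycle.setoid σ)) :
      IsEffectiveCycle Q R (cycleMap σ j.out) := by
    refine ⟨minimalPeriod_perm_pos σ _, cycleMap_injective σ _, fun i => ?_⟩
    have hR := (hσ _ _).mpr (cycleMap_add_one σ j.out i)
    exact ⟨hcg.1 hR, hR⟩
  have hbij := bijective_sigma_cycleMap σ
  refine ⟨Quotient (Equiv.Perm.SameCycle.setoid σ), Fintype.ofFinite _, _, _, hcyc, hbij,
    fun m' c' hc' => ⟨Quotient.mk _ (c' 0), ?_⟩, bijOn_repSet_comp d hσ hcyc hbij,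
    fun g M j i => castMat_gl_mul_mul g ((hcyc j).2.2 i).1 _ _⟩
  have h0 : σ.SameCycle (Quotient.mk (Equiv.Perm.SameCycle.setoid σ) (c' 0)).out (c' 0) :=
    Quotient.mk_out (s := Equiv.Perm.SameCycle.setoid σ) (c' 0)
  rw [range_eq_sameCycle_of_add_one σ hc'.1 fun i => (hσ _ _).mp (hc'.2.2 i).2, range_cycleMap]
  ext b
  exact ⟨h0.trans, h0.symm.trans⟩
end
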